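/- arXiv:2407.19822 — 5 statements merged into one kernel-verified Lean document; each statement's English description precedes it below -/
import Mathlib

section
/- Let L₀ ⊆ ℝ^d be a nonempty finite set, w₀ : L₀ → ℝ a weight function, v ∈ convexHull(L₀), and W ∈ ℝ with W > max_{x ∈ L₀} w₀(x). Set Q₀ := convexHull({(x, w₀(x)) : x ∈ L₀}) and Q₁ := convexHull(Q₀ ∪ {(v, W)}). Then: (i) there exists t ≤ max_{x ∈ L₀} w₀(x) with (v, t) ∈ Q₀; and (ii) for every lower functional u one has min_{Q₁} u = min_{Q₀} u and {z ∈ Q₁ : u(z) = min_{Q₁} u} = {z ∈ Q₀ : u(z) = min_{Q₀} u}. In particular, the lifted point (v, W) lies on no exposed lower face of Q₁, and Q₀ and Q₁ have exactly the same lower facets. -/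
open Set

/-- Affine dimension of a subset of a real vector space. -/
noncomputable def setDim {V : Type*} [AddCommGroup V] [Module ℝ V] (s : Set V) : ℕ :=
  Module.finrank ℝ (affineSpan ℝ s).direction

/-- A linear functional on `ℝ^d × ℝ` is lower if it is positive on `(0, 1)`. -/
def IsLowerFn {d : ℕ} (u : ((Fin d → ℝ) × ℝ) →ₗ[ℝ] ℝ) : Prop := 0 < u (0, 1)

/-- The exposed lower face of `Q` at the functional `u`: the set of minimizers of `u` on `Q`. -/
def lowerFace {d : ℕ} (Q : Set ((Fin d → ℝ) × ℝ)) (u : ((Fin d → ℝ) × ℝ) →ₗ[ℝ] ℝ) :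
    Set ((Fin d → ℝ) × ℝ) := {z ∈ Q | ∀ y ∈ Q, u z ≤ u y}

/-- A lower facet of `Q`: an exposed lower face of `Q` at a lower functional whose dimension
equals the dimension of `convexHull (π '' Q)`. -/
def IsLowerFacet {d : ℕ} (Q F : Set ((Fin d → ℝ) × ℝ)) : Prop :=
  ∃ u, IsLowerFn u ∧ F = lowerFace Q u ∧
    setDim F = setDim (convexHull ℝ (Prod.fst '' Q))

/-- The lifted polytope `Q_w` of a finite set of real points with real weights. -/
noncomputable def liftR {d : ℕ} (L : Finset (Fin d → ℝ)) (w : (Fin d → ℝ) → ℝ) :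
    Set ((Fin d → ℝ) × ℝ) :=
  convexHull ℝ ((fun x => (x, w x)) '' (L : Set (Fin d → ℝ)))

/-- adding a lifted point `(v, W)` with `v ∈ conv L₀` and `W` above all weights does
not change minima of lower functionals, their minimizer sets, nor the lower facets; in particular
`(v, W)` lies on no exposed lower face of `Q₁`. -/
theorem stmt2 (d : ℕ) (L₀ : Finset (Fin d → ℝ)) (hne : L₀.Nonempty)
    (w₀ : (Fin d → ℝ) → ℝ) (v : Fin d → ℝ)
    (hv : v ∈ convexHull ℝ (L₀ : Set (Fin d → ℝ)))
    (W : ℝ) (hW : L₀.sup' hne w₀ < W) :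
    (∃ t : ℝ, t ≤ L₀.sup' hne w₀ ∧ (v, t) ∈ liftR L₀ w₀) ∧
    (∀ u : ((Fin d → ℝ) × ℝ) →ₗ[ℝ] ℝ, IsLowerFn u →
      (∀ c : ℝ, IsLeast (u '' convexHull ℝ (liftR L₀ w₀ ∪ {(v, W)})) c ↔
        IsLeast (u '' liftR L₀ w₀) c) ∧
      lowerFace (convexHull ℝ (liftR L₀ w₀ ∪ {(v, W)})) u = lowerFace (liftR L₀ w₀) u) ∧
    (∀ u : ((Fin d → ℝ) × ℝ) →ₗ[ℝ] ℝ, IsLowerFn u →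
      (v, W) ∉ lowerFace (convexHull ℝ (liftR L₀ w₀ ∪ {(v, W)})) u) ∧
    (∀ F, IsLowerFacet (liftR L₀ w₀) F ↔
      IsLowerFacet (convexHull ℝ (liftR L₀ w₀ ∪ {(v, W)})) F) := by
  have h1 : ∃ t : ℝ, t ≤ L₀.sup' hne w₀ ∧ (v, t) ∈ liftR L₀ w₀ := by
    have hconv : Convex ℝ {x : Fin d → ℝ | ∃ t : ℝ, t ≤ L₀.sup' hne w₀ ∧ (x, t) ∈ liftR L₀ w₀} := by
      rintro x ⟨s, hs, hxs⟩ y ⟨t, ht, hyt⟩ a b ha hb hab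
      refine ⟨a * s + b * t, ?_, ?_⟩
      · calc a * s + b * t ≤ a * L₀.sup' hne w₀ + b * L₀.sup' hne w₀ := by gcongr
          _ = L₀.sup' hne w₀ := by rw [← add_mul, hab, one_mul]
      · have := (convex_convexHull ℝ ((fun x => (x, w₀ x)) '' (L₀ : Set (Fin d → ℝ)))) hxs hyt ha hb hab
        simpa [liftR] using this
    have hsub : (L₀ : Set (Fin d → ℝ)) ⊆
        {x : Fin d → ℝ | ∃ t : ℝ, t ≤ L₀.sup' hne w₀ ∧ (x, t) ∈ liftR L₀ w₀} := fun x hx =>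
      ⟨w₀ x, Finset.le_sup' w₀ hx, subset_convexHull ℝ _ ⟨x, hx, rfl⟩⟩
    exact convexHull_min hsub hconv hv
  refine ⟨h1, ?_⟩
  obtain ⟨t, ht, hvt⟩ := h1
  have htW : 0 < W - t := by linarith
  have hQ : Convex ℝ (liftR L₀ w₀) := convex_convexHull ℝ _
  generalize liftR L₀ w₀ = Q at *
  have hsub : Q ⊆ convexHull ℝ (Q ∪ {(v, W)}) :=
    subset_union_left.trans (subset_convexHull ℝ _)
  have hp : (v, W) ∈ convexHull ℝ (Q ∪ {(v, W)}) :=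
    subset_convexHull ℝ _ (Or.inr rfl)
  have key : ∀ z ∈ convexHull ℝ (Q ∪ {(v, W)}), z ∈ Q ∨ ∃ y ∈ Q, ∃ s : ℝ, 0 < s ∧
      z = y + s • ((0, 1) : (Fin d → ℝ) × ℝ) := by
    intro z hz
    rw [union_singleton, convexHull_insert ⟨_, hvt⟩, hQ.convexHull_eq, mem_convexJoin] at hz
    obtain ⟨p, rfl, q, hq, a, b, ha, hb, hab, rfl⟩ := hz
    rcases ha.eq_or_lt with rfl | ha'
    · left
      have : b = 1 := by linarith
      simpa [this] using hq
    · right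
      refine ⟨a • (v, t) + b • q, hQ hvt hq ha hb hab, a * (W - t), mul_pos ha' htW, ?_⟩
      ext
      · simp
      · simp
        ring
  generalize convexHull ℝ (Q ∪ {(v, W)}) = Q1 at *
  have key2 : ∀ u : ((Fin d → ℝ) × ℝ) →ₗ[ℝ] ℝ, IsLowerFn u → ∀ z ∈ Q1, z ∈ Q ∨ ∃ y ∈ Q, u y < u z := by
    intro u hu z hz
    rcases key z hz with h | ⟨y, hy, s, hs, rfl⟩
    · exact Or.inl h
    · refine Or.inr ⟨y, hy, ?_⟩
      rw [map_add, map_smul, smul_eq_mul]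
      have := mul_pos hs hu
      linarith
  have face : ∀ u : ((Fin d → ℝ) × ℝ) →ₗ[ℝ] ℝ, IsLowerFn u → lowerFace Q1 u = lowerFace Q u := by
    intro u hu
    ext z
    constructor
    · rintro ⟨hz, hm⟩
      refine ⟨?_, fun y hy => hm y (hsub hy)⟩
      rcases key2 u hu z hz with h | ⟨y, hy, h⟩
      · exact h
      · exact absurd (hm y (hsub hy)) (not_le.2 h)
    · rintro ⟨hz, hm⟩
      refine ⟨hsub hz, fun y hy => ?_⟩
      rcases key2 u hu y hy with h | ⟨x, hx, h⟩
      · exact hm y h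
      · exact (hm x hx).trans h.le
  have least : ∀ (R : Set ((Fin d → ℝ) × ℝ)) (u : ((Fin d → ℝ) × ℝ) →ₗ[ℝ] ℝ) (c : ℝ),
      IsLeast (u '' R) c ↔ ∃ z ∈ lowerFace R u, u z = c := by
    intro R u c
    constructor
    · rintro ⟨⟨z, hz, rfl⟩, hm⟩
      exact ⟨z, ⟨hz, fun y hy => hm ⟨y, hy, rfl⟩⟩, rfl⟩
    · rintro ⟨z, ⟨hz, hm⟩, rfl⟩
      refine ⟨⟨z, hz, rfl⟩, ?_⟩
      rintro _ ⟨y, hy, rfl⟩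
      exact hm y hy
  have himg : Prod.fst '' Q1 = Prod.fst '' Q := by
    apply Subset.antisymm _ (image_mono hsub)
    rintro _ ⟨z, hz, rfl⟩
    rcases key z hz with h | ⟨y, hy, s, hs, rfl⟩
    · exact ⟨z, h, rfl⟩
    · exact ⟨y, hy, by simp⟩
  refine ⟨fun u hu => ⟨fun c => ?_, face u hu⟩, fun u hu hmem => ?_, fun F => ?_⟩
  · rw [least, least, face u hu]
  · have h := hmem.2 (v, t) (hsub hvt)
    have e : ((v, W) : (Fin d → ℝ) × ℝ) = (v, t) + (W - t) • ((0, 1) : (Fin d → ℝ) × ℝ) := by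
      ext <;> simp
    rw [e, map_add, map_smul, smul_eq_mul] at h
    have := mul_pos htW hu
    linarith
  · unfold IsLowerFacet
    rw [himg]
    refine exists_congr fun u => and_congr_right fun hu => ?_
    rw [face u hu]
end

section
/- Let L₀ ⊆ ℝ^d be a nonempty finite set, w₀ : L₀ → ℝ≥0 a weight function, and v ∈ ℝ^d an arbitrary point. Then there exists W ∈ ℝ≥0 such that, setting Q₀ := convexHull({(x, w₀(x)) : x ∈ L₀}) and Q₁ := convexHull(Q₀ ∪ {(v, W)}), every lower facet F of Q₀ is an exposed lower face of Q₁, i.e., for every lower facet F of Q₀ there exists a lower functional u with F = {z ∈ Q₁ : u(z) = min_{Q₁} u}. Moreover, if L₀ ⊆ ℚ^d, w₀ takes values in ℚ, and v ∈ ℚ^d, then W can be chosen in ℚ≥0. -/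
open Set

theorem aux_mem {E : Type*} [AddCommGroup E] [Module ℝ E] (P : Finset E) (u : E →ₗ[ℝ] ℝ) (z : E)
    (hz : z ∈ convexHull ℝ (P : Set E)) (hm : ∀ p ∈ P, u z ≤ u p) :
    z ∈ convexHull ℝ ({p ∈ (P : Set E) | u p = u z}) := by
  classical
  obtain ⟨w, h0, h1, h2⟩ := Finset.mem_convexHull'.1 hz
  have hs : ∑ y ∈ P, w y * (u y - u z) = 0 := by
    have : u z = ∑ y ∈ P, w y * u y := by
      conv_lhs => rw [← h2]
      simp
    simp only [mul_sub, Finset.sum_sub_distrib, ← Finset.sum_mul, h1]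
    linarith
  have hall := (Finset.sum_eq_zero_iff_of_nonneg
    (fun y hy => mul_nonneg (h0 y hy) (sub_nonneg.2 (hm y hy)))).1 hs
  have hne : ∀ y ∈ P, w y ≠ 0 → u y = u z := fun y hy hw => by
    have := (mul_eq_zero.1 (hall y hy)).resolve_left hw
    linarith
  have hc : {p ∈ (P : Set E) | u p = u z} = ((P.filter (fun p => u p = u z) : Finset E) : Set E) := by
    ext; simp
  rw [hc, Finset.mem_convexHull']
  refine ⟨w, fun y hy => h0 y (Finset.mem_filter.1 hy).1, ?_, ?_⟩
  · rw [Finset.sum_filter_of_ne hne, h1]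
  · rw [Finset.sum_filter_of_ne, h2]
    intro y hy hw
    exact hne y hy (fun h => hw (by simp [h]))

theorem aux_le {E : Type*} [AddCommGroup E] [Module ℝ E] (P : Set E) (u : E →ₗ[ℝ] ℝ) (c : ℝ)
    (h : ∀ p ∈ P, c ≤ u p) : ∀ p ∈ convexHull ℝ P, c ≤ u p := fun _ hp =>
  convexHull_min (t := {p | c ≤ u p}) h (convex_halfSpace_ge u.isLinear c) hp

theorem aux_face {d : ℕ} (P : Finset ((Fin d → ℝ) × ℝ)) (hP : P.Nonempty)
    (u : ((Fin d → ℝ) × ℝ) →ₗ[ℝ] ℝ) :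
    ∃ z0 ∈ convexHull ℝ (P : Set ((Fin d → ℝ) × ℝ)),
      (∀ y ∈ convexHull ℝ (P : Set ((Fin d → ℝ) × ℝ)), u z0 ≤ u y) ∧
      lowerFace (convexHull ℝ (P : Set ((Fin d → ℝ) × ℝ))) u =
        convexHull ℝ {p ∈ (P : Set ((Fin d → ℝ) × ℝ)) | u p = u z0} := by
  obtain ⟨z0, hz0, hmin⟩ := P.exists_min_image u hP
  have hz0' := subset_convexHull ℝ (P : Set ((Fin d → ℝ) × ℝ)) hz0
  have hmin' := aux_le (P : Set ((Fin d → ℝ) × ℝ)) u (u z0) hmin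
  refine ⟨z0, hz0', hmin', ?_⟩
  ext z
  constructor
  · rintro ⟨hz, hzm⟩
    have he : u z = u z0 := le_antisymm (hzm z0 hz0') (hmin' z hz)
    rw [← he]
    exact aux_mem P u z hz (fun p hp => he ▸ hmin p hp)
  · intro hz
    refine ⟨convexHull_mono (fun p hp => hp.1) hz, fun y hy => ?_⟩
    have : z ∈ {p | u p ≤ u z0} :=
      convexHull_min (fun p hp => hp.2.le) (convex_halfSpace_le u.isLinear _) hz
    exact le_trans this (hmin' y hy)

theorem aux_add {d : ℕ} (Q : Set ((Fin d → ℝ) × ℝ)) (hQ : Convex ℝ Q)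
    (u : ((Fin d → ℝ) × ℝ) →ₗ[ℝ] ℝ) (z0 p : (Fin d → ℝ) × ℝ) (hz0 : z0 ∈ Q)
    (hmin : ∀ y ∈ Q, u z0 ≤ u y) (hp : u z0 < u p) :
    lowerFace Q u = lowerFace (convexHull ℝ (Q ∪ {p})) u := by
  have hle : ∀ y ∈ convexHull ℝ (Q ∪ {p}), u z0 ≤ u y := by
    apply aux_le
    rintro y (hy | hy)
    · exact hmin y hy
    · rw [mem_singleton_iff.1 hy]; exact hp.le
  have hsub : Q ⊆ convexHull ℝ (Q ∪ {p}) := subset_union_left.trans (subset_convexHull ℝ _)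
  ext z
  constructor
  · rintro ⟨hz, hm⟩
    exact ⟨hsub hz, fun y hy => (hm z0 hz0).trans (hle y hy)⟩
  · rintro ⟨hz, hm⟩
    refine ⟨?_, fun y hy => hm y (hsub hy)⟩
    have hm0 := hm z0 (hsub hz0)
    rw [union_singleton, convexHull_insert ⟨z0, hz0⟩, hQ.convexHull_eq, mem_convexJoin] at hz
    obtain ⟨x, hx, q, hq, a, b, ha, hb, hab, rfl⟩ := hz
    rw [mem_singleton_iff.1 hx] at hm0 ⊢
    simp only [map_add, map_smul, smul_eq_mul] at hm0
    have h1 := mul_le_mul_of_nonneg_left (hmin q hq) hb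
    have hb' : b = 1 - a := by linarith
    have ha0 : a = 0 := by
      by_contra hne
      have : 0 < a := lt_of_le_of_ne ha (Ne.symm hne)
      have := mul_lt_mul_of_pos_left hp this
      subst hb'
      linarith
    subst ha0
    simpa [hb'] using hq

theorem aux_main (d : ℕ) (L₀ : Finset (Fin d → ℝ)) (hne : L₀.Nonempty)
    (w₀ : (Fin d → ℝ) → ℝ) (v : Fin d → ℝ) :
    ∃ W : ℕ, ∀ F, IsLowerFacet (liftR L₀ w₀) F →
        ∃ u, IsLowerFn u ∧ F = lowerFace (convexHull ℝ (liftR L₀ w₀ ∪ {(v, (W : ℝ))})) u := by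
  classical
  obtain ⟨P, hP⟩ : ∃ P : Finset ((Fin d → ℝ) × ℝ), P = L₀.image (fun x => (x, w₀ x)) := ⟨_, rfl⟩
  have hPne : P.Nonempty := hP ▸ hne.image _
  have hL : liftR L₀ w₀ = convexHull ℝ (P : Set ((Fin d → ℝ) × ℝ)) := by
    simp [liftR, hP]
  rw [hL]
  have hfin : {F | IsLowerFacet (convexHull ℝ (P : Set ((Fin d → ℝ) × ℝ))) F}.Finite := by
    refine ((P.finite_toSet.finite_subsets).image (fun S => convexHull ℝ S)).subset ?_
    rintro F ⟨u, -, hF, -⟩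
    obtain ⟨z0, -, -, h⟩ := aux_face P hPne u
    exact ⟨_, fun p hp => hp.1, (hF.trans h).symm⟩
  have hev : ∀ᶠ W : ℕ in Filter.atTop,
      ∀ F ∈ {F | IsLowerFacet (convexHull ℝ (P : Set ((Fin d → ℝ) × ℝ))) F},
        ∃ u, IsLowerFn u ∧ F = lowerFace (convexHull ℝ
          (convexHull ℝ (P : Set ((Fin d → ℝ) × ℝ)) ∪ {(v, (W : ℝ))})) u := by
    rw [Filter.eventually_all_finite hfin]
    rintro F ⟨u, hu, hF, -⟩
    obtain ⟨z0, hz0, hmin, -⟩ := aux_face P hPne u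
    have ht := (tendsto_natCast_atTop_atTop (R := ℝ)).eventually_gt_atTop
      ((u z0 - u (v, 0)) / u (0, 1))
    filter_upwards [ht] with W hW
    refine ⟨u, hu, hF.trans (aux_add _ (convex_convexHull ℝ _) u z0 _ hz0 hmin ?_)⟩
    have h1 : ((v, (W : ℝ)) : (Fin d → ℝ) × ℝ) = (v, 0) + (W : ℝ) • (0, 1) := by simp
    rw [h1, map_add, map_smul, smul_eq_mul]
    rw [div_lt_iff₀ hu] at hW
    linarith
  exact hev.exists

/-- for a nonempty finite `L₀ ⊆ ℝ^d` with nonnegative weights `w₀` and any point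
`v ∈ ℝ^d`, there is `W ≥ 0` such that every lower facet of `Q₀` is an exposed lower face of
`Q₁ = conv (Q₀ ∪ {(v, W)})`; moreover for rational data `W` can be chosen rational. -/
theorem stmt3 (d : ℕ) (L₀ : Finset (Fin d → ℝ)) (hne : L₀.Nonempty)
    (w₀ : (Fin d → ℝ) → ℝ) (hw₀ : ∀ x ∈ L₀, 0 ≤ w₀ x) (v : Fin d → ℝ) :
    (∃ W : ℝ, 0 ≤ W ∧
      ∀ F, IsLowerFacet (liftR L₀ w₀) F →
        ∃ u, IsLowerFn u ∧ F = lowerFace (convexHull ℝ (liftR L₀ w₀ ∪ {(v, W)})) u) ∧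
    ((∀ x ∈ L₀, ∀ i, ∃ q : ℚ, x i = (q : ℝ)) → (∀ x ∈ L₀, ∃ q : ℚ, w₀ x = (q : ℝ)) →
      (∀ i, ∃ q : ℚ, v i = (q : ℝ)) →
      ∃ W : ℝ, 0 ≤ W ∧ (∃ q : ℚ, W = (q : ℝ)) ∧
        ∀ F, IsLowerFacet (liftR L₀ w₀) F →
          ∃ u, IsLowerFn u ∧ F = lowerFace (convexHull ℝ (liftR L₀ w₀ ∪ {(v, W)})) u) := by
  obtain ⟨W, hW⟩ := aux_main d L₀ hne w₀ v
  exact ⟨⟨W, Nat.cast_nonneg W, hW⟩, fun _ _ _ => ⟨W, Nat.cast_nonneg W, ⟨(W : ℚ), by simp⟩, hW⟩⟩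
end

section
/- Let v₁, …, v_r ∈ ℝ^d be points lying on the affine hyperplane H = {x ∈ ℝ^d : ⟨m, x⟩ = 1} for some m ∈ ℝ^d (so 0 ∉ H), and let w₁, …, w_r ≥ 0. Let C := {Σ_{i=1}^r a_i (v_i, w_i) : a_i ≥ 0 for all i} ⊆ ℝ^d × ℝ be the cone generated by the lifted points and C_ν := {Σ_{i=1}^r a_i v_i : a_i ≥ 0 for all i} ⊆ ℝ^d the cone generated by v₁, …, v_r. Then for every x ∈ C_ν the fiber T_x := {t ∈ ℝ : (x, t) ∈ C} is a nonempty compact subset of the interval [0, ⟨m, x⟩ · max_i w_i]; hence the lower envelope Φ(x) := min T_x is well-defined. Moreover, Φ : C_ν → ℝ is positively homogeneous (Φ(a·x) = a·Φ(x) for all a ≥ 0 and x ∈ C_ν) and convex (Φ(λx + (1−λ)y) ≤ λΦ(x) + (1−λ)Φ(y) for all x, y ∈ C_ν and λ ∈ [0,1]). -/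
open Set

/-- The cone generated by a finite list of vectors: all nonnegative linear combinations. -/
def coneOf {V : Type*} [AddCommGroup V] [Module ℝ V] {r : ℕ} (g : Fin r → V) : Set V :=
  {z | ∃ a : Fin r → ℝ, (∀ i, 0 ≤ a i) ∧ z = ∑ i, a i • g i}

theorem aux_mem_s5 {d r : ℕ} (v : Fin r → (Fin d → ℝ)) (w : Fin r → ℝ) (x : Fin d → ℝ) (t : ℝ) :
    (x, t) ∈ coneOf (fun i => ((v i, w i) : (Fin d → ℝ) × ℝ)) ↔
      ∃ a : Fin r → ℝ, (∀ i, 0 ≤ a i) ∧ x = ∑ i, a i • v i ∧ t = ∑ i, a i * w i := by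
  simp [coneOf, Prod.ext_iff, Prod.fst_sum, Prod.snd_sum]

theorem aux_smul {V : Type*} [AddCommGroup V] [Module ℝ V] {r : ℕ} {g : Fin r → V} {z : V}
    {c : ℝ} (hc : 0 ≤ c) (hz : z ∈ coneOf g) : c • z ∈ coneOf g := by
  obtain ⟨a, ha, rfl⟩ := hz
  exact ⟨fun i => c * a i, fun i => mul_nonneg hc (ha i), by simp [Finset.smul_sum, mul_smul]⟩

theorem aux_add_s5 {V : Type*} [AddCommGroup V] [Module ℝ V] {r : ℕ} {g : Fin r → V} {y z : V}
    (hy : y ∈ coneOf g) (hz : z ∈ coneOf g) : y + z ∈ coneOf g := by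
  obtain ⟨a, ha, rfl⟩ := hy
  obtain ⟨b, hb, rfl⟩ := hz
  exact ⟨fun i => a i + b i, fun i => add_nonneg (ha i) (hb i),
    by simp [add_smul, Finset.sum_add_distrib]⟩

theorem aux_pair {d r : ℕ} (v : Fin r → (Fin d → ℝ)) (m : Fin d → ℝ)
    (hv : ∀ i, ∑ j, m j * v i j = 1) (a : Fin r → ℝ) :
    ∑ j, m j * (∑ i, a i • v i) j = ∑ i, a i := by
  have : ∀ i, a i = ∑ j, m j * (a i * v i j) := by
    intro i
    have h : ∑ j, m j * (a i * v i j) = a i * ∑ j, m j * v i j := by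
      rw [Finset.mul_sum]
      exact Finset.sum_congr rfl fun j _ => by ring
    rw [h, hv, mul_one]
  rw [Finset.sum_congr rfl fun i _ => this i, Finset.sum_comm]
  simp [Finset.sum_apply, Finset.mul_sum]

theorem aux_compact {d r : ℕ} (v : Fin r → (Fin d → ℝ)) (m : Fin d → ℝ)
    (hv : ∀ i, ∑ j, m j * v i j = 1) (w : Fin r → ℝ) (x : Fin d → ℝ) :
    IsCompact {t : ℝ | (x, t) ∈ coneOf (fun i => ((v i, w i) : (Fin d → ℝ) × ℝ))} := by
  have hK : IsCompact (Set.Icc (0 : Fin r → ℝ) (fun _ => ∑ j, m j * x j) ∩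
      {a | x = ∑ i, a i • v i}) := by
    apply isCompact_Icc.inter_right
    exact isClosed_eq continuous_const (by fun_prop)
  have hc : Continuous fun a : Fin r → ℝ => ∑ i, a i * w i := by fun_prop
  convert hK.image hc using 1
  ext t
  rw [Set.mem_setOf_eq, aux_mem_s5]
  constructor
  · rintro ⟨a, ha, hx, ht⟩
    refine ⟨a, ⟨⟨ha, fun i => ?_⟩, hx⟩, ht.symm⟩
    rw [hx, aux_pair v m hv a]
    exact Finset.single_le_sum (fun i _ => ha i) (Finset.mem_univ i)
  · rintro ⟨a, ⟨⟨ha, -⟩, hx⟩, ht⟩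
    exact ⟨a, ha, hx, ht.symm⟩

/-- for points `v₁, …, v_r` on the affine hyperplane `⟨m, ·⟩ = 1` and nonnegative
weights `w₁, …, w_r`, each fiber `T_x = {t : (x, t) ∈ C}` over `x ∈ C_ν` is a nonempty compact
subset of `[0, ⟨m, x⟩ · max_i w_i]`, the lower envelope `Φ(x) = min T_x` is well-defined
(`sInf T_x` is a least element), and `Φ` is positively homogeneous and convex on `C_ν`. -/
theorem stmt5 (d r : ℕ) (hr : 0 < r) (v : Fin r → (Fin d → ℝ)) (m : Fin d → ℝ)
    (hv : ∀ i, ∑ j, m j * v i j = 1) (w : Fin r → ℝ) (hw : ∀ i, 0 ≤ w i) :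
    (∀ x ∈ coneOf v,
      {t : ℝ | (x, t) ∈ coneOf (fun i => ((v i, w i) : (Fin d → ℝ) × ℝ))}.Nonempty ∧
      IsCompact {t : ℝ | (x, t) ∈ coneOf (fun i => ((v i, w i) : (Fin d → ℝ) × ℝ))} ∧
      {t : ℝ | (x, t) ∈ coneOf (fun i => ((v i, w i) : (Fin d → ℝ) × ℝ))} ⊆
        Set.Icc 0 ((∑ j, m j * x j) *
          Finset.univ.sup' (Finset.univ_nonempty_iff.mpr ⟨(⟨0, hr⟩ : Fin r)⟩) w) ∧
      IsLeast {t : ℝ | (x, t) ∈ coneOf (fun i => ((v i, w i) : (Fin d → ℝ) × ℝ))}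
        (sInf {t : ℝ | (x, t) ∈ coneOf (fun i => ((v i, w i) : (Fin d → ℝ) × ℝ))})) ∧
    (∀ a : ℝ, 0 ≤ a → ∀ x ∈ coneOf v,
      sInf {t : ℝ | (a • x, t) ∈ coneOf (fun i => ((v i, w i) : (Fin d → ℝ) × ℝ))} =
        a * sInf {t : ℝ | (x, t) ∈ coneOf (fun i => ((v i, w i) : (Fin d → ℝ) × ℝ))}) ∧
    (∀ x ∈ coneOf v, ∀ y ∈ coneOf v, ∀ l : ℝ, 0 ≤ l → l ≤ 1 →
      sInf {t : ℝ | (l • x + (1 - l) • y, t) ∈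
          coneOf (fun i => ((v i, w i) : (Fin d → ℝ) × ℝ))} ≤
        l * sInf {t : ℝ | (x, t) ∈ coneOf (fun i => ((v i, w i) : (Fin d → ℝ) × ℝ))} +
        (1 - l) * sInf {t : ℝ | (y, t) ∈ coneOf (fun i => ((v i, w i) : (Fin d → ℝ) × ℝ))}) := by
  have hne : ∀ x ∈ coneOf v,
      {t : ℝ | (x, t) ∈ coneOf (fun i => ((v i, w i) : (Fin d → ℝ) × ℝ))}.Nonempty := by
    rintro x ⟨a, ha, hx⟩
    exact ⟨_, (aux_mem_s5 v w x _).2 ⟨a, ha, hx, rfl⟩⟩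
  have hnn : ∀ x t, (x, t) ∈ coneOf (fun i => ((v i, w i) : (Fin d → ℝ) × ℝ)) → 0 ≤ t := by
    intro x t h
    obtain ⟨a, ha, -, rfl⟩ := (aux_mem_s5 v w x t).1 h
    exact Finset.sum_nonneg fun i _ => mul_nonneg (ha i) (hw i)
  have hleast : ∀ x ∈ coneOf v,
      IsLeast {t : ℝ | (x, t) ∈ coneOf (fun i => ((v i, w i) : (Fin d → ℝ) × ℝ))}
        (sInf {t : ℝ | (x, t) ∈ coneOf (fun i => ((v i, w i) : (Fin d → ℝ) × ℝ))}) :=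
    fun x hx => (aux_compact v m hv w x).isLeast_sInf (hne x hx)
  refine ⟨fun x hx => ⟨hne x hx, aux_compact v m hv w x, ?_, hleast x hx⟩, ?_, ?_⟩
  · intro t ht
    refine ⟨hnn x t ht, ?_⟩
    obtain ⟨a, ha, rfl, rfl⟩ := (aux_mem_s5 v w x t).1 ht
    rw [aux_pair v m hv a, Finset.sum_mul]
    exact Finset.sum_le_sum fun i _ =>
      mul_le_mul_of_nonneg_left (Finset.le_sup' w (Finset.mem_univ i)) (ha i)
  · intro a ha x hx
    have h1 := hleast x hx
    have h2 := hleast (a • x) (aux_smul ha hx)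
    apply le_antisymm
    · exact h2.2 (aux_smul ha h1.1)
    · rcases ha.eq_or_lt with h0 | hpos
      · have := hnn _ _ h2.1
        rw [← h0, zero_mul]
        rwa [← h0] at this
      · have h3 := aux_smul (inv_nonneg.2 ha) h2.1
        rw [Prod.smul_mk, inv_smul_smul₀ hpos.ne'] at h3
        have h4 := h1.2 h3
        rw [smul_eq_mul, ← div_eq_inv_mul, le_div_iff₀ hpos] at h4
        linarith
  · intro x hx y hy l hl hl1
    have hl' : 0 ≤ 1 - l := sub_nonneg.2 hl1
    exact (hleast _ (aux_add_s5 (aux_smul hl hx) (aux_smul hl' hy))).2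
      (aux_add_s5 (aux_smul hl (hleast x hx).1) (aux_smul hl' (hleast y hy).1))
end

section
/- Let v₁, …, v_r ∈ ℚ^d be points lying on the affine hyperplane {x ∈ ℝ^d : ⟨m, x⟩ = 1} for some m ∈ ℚ^d, let w₁, …, w_r ∈ ℚ with w_i ≥ 0, and let C := {Σ_{i=1}^r a_i (v_i, w_i) : a_i ≥ 0} ⊆ ℝ^d × ℝ and C_ν := {Σ_{i=1}^r a_i v_i : a_i ≥ 0} ⊆ ℝ^d. Then for every rational point x ∈ C_ν ∩ ℚ^d, the value Φ(x) := min{t ∈ ℝ : (x, t) ∈ C} is a rational number; in particular, if additionally x ≠ 0 and all w_i > 0, then Φ(x) ∈ ℚ_{>0}. -/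
open Set

/-- Embedding of rational vectors into real vectors. -/
def rk {d : ℕ} (x : Fin d → ℚ) : Fin d → ℝ := fun i => (x i : ℝ)

lemma exists_eps {r : ℕ} (a c : Fin r → ℝ) (ha : ∀ i, 0 ≤ a i) (hc : ∀ i, a i = 0 → c i = 0) :
    ∃ e : ℝ, 0 < e ∧ ∀ i, 0 ≤ a i + e * c i := by
  have h : ∀ᶠ e in nhdsWithin (0 : ℝ) (Ioi 0), ∀ i, 0 ≤ a i + e * c i := by
    rw [Filter.eventually_all]
    intro i
    rcases (ha i).eq_or_lt with h0 | h0
    · refine Filter.Eventually.of_forall fun e => ?_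
      rw [hc i h0.symm, ← h0]; simp
    · apply Filter.Eventually.filter_mono nhdsWithin_le_nhds
      have hcont : ContinuousAt (fun e : ℝ => a i + e * c i) 0 := by fun_prop
      have := hcont.eventually (lt_mem_nhds (a := 0) (by simpa using h0))
      exact this.mono fun e he => le_of_lt he
  obtain ⟨e, he, hpos⟩ := (h.and self_mem_nhdsWithin).exists
  exact ⟨e, hpos, he⟩

theorem stmt6 (d r : ℕ) (v : Fin r → (Fin d → ℚ)) (m : Fin d → ℚ)
    (hv : ∀ i, ∑ j, m j * v i j = 1) (w : Fin r → ℚ) (hw : ∀ i, 0 ≤ w i) :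
    ∀ x : Fin d → ℚ, rk x ∈ coneOf (fun i => rk (v i)) →
      ∀ t : ℝ, IsLeast {s : ℝ | (rk x, s) ∈
          coneOf (fun i => ((rk (v i), (w i : ℝ)) : (Fin d → ℝ) × ℝ))} t →
        (∃ q : ℚ, t = (q : ℝ)) ∧
        (rk x ≠ 0 → (∀ i, 0 < w i) → ∃ q : ℚ, 0 < q ∧ t = (q : ℝ)) := by
  intro x _ t ht
  have key : ∀ s : ℝ, (rk x, s) ∈
      coneOf (fun i => ((rk (v i), (w i : ℝ)) : (Fin d → ℝ) × ℝ)) ↔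
      ∃ a : Fin r → ℝ, (∀ i, 0 ≤ a i) ∧ (∀ j, (x j : ℝ) = ∑ i, a i * (v i j : ℝ)) ∧
        s = ∑ i, a i * (w i : ℝ) := by
    intro s
    simp only [coneOf, mem_setOf_eq, Prod.ext_iff, Prod.fst_sum, Prod.snd_sum, funext_iff,
      Finset.sum_apply, Prod.smul_fst, Prod.smul_snd, Pi.smul_apply, smul_eq_mul, rk]
  obtain ⟨hmem, hlow⟩ := ht
  obtain ⟨a, ha, hax, hat⟩ := (key t).1 hmem
  obtain ⟨φ, hφ⟩ := LinearMap.exists_leftInverse_of_injective (Algebra.linearMap ℚ ℝ)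
    (LinearMap.ker_eq_bot.2 (algebraMap ℚ ℝ).injective)
  have hφq : ∀ q : ℚ, φ (q : ℝ) = q := fun q => by
    simpa using LinearMap.congr_fun hφ q
  have hφm : ∀ (y : ℝ) (q : ℚ), φ (y * (q : ℝ)) = φ y * q := fun y q => by
    have := φ.map_smul q y
    rw [Rat.smul_def] at this
    rw [mul_comm, this, smul_eq_mul, mul_comm]
  let c : Fin r → ℝ := fun i => (φ (a i) : ℝ) - a i
  have hc0 : ∀ i, a i = 0 → c i = 0 := fun i hi => by simp [c, hi]
  have hcv : ∀ j, ∑ i, c i * (v i j : ℝ) = 0 := by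
    intro j
    have h1 : x j = ∑ i, φ (a i) * v i j := by
      rw [← hφq (x j), hax j, map_sum]; simp [hφm]
    have h2 : (x j : ℝ) = ∑ i, (φ (a i) : ℝ) * (v i j : ℝ) := by
      rw [h1]; push_cast; rfl
    simp only [c, sub_mul, Finset.sum_sub_distrib]
    rw [← h2, ← hax j, sub_self]
  have main : ∀ c : Fin r → ℝ, (∀ i, a i = 0 → c i = 0) →
      (∀ j, ∑ i, c i * (v i j : ℝ) = 0) → 0 ≤ ∑ i, c i * (w i : ℝ) := by
    intro c hc0 hcv
    obtain ⟨e, he, hpos⟩ := exists_eps a c ha hc0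
    have := hlow ((key _).2 ⟨fun i => a i + e * c i, hpos, fun j => by
      simp only [add_mul, mul_assoc, Finset.sum_add_distrib, ← Finset.mul_sum]
      rw [hcv j, ← hax j]; simp, rfl⟩)
    simp only [add_mul, mul_assoc, Finset.sum_add_distrib, ← Finset.mul_sum] at this
    rw [← hat] at this
    have h3 : 0 ≤ e * ∑ i, c i * (w i : ℝ) := by linarith
    exact nonneg_of_mul_nonneg_right h3 he
  have h1 := main c hc0 hcv
  have h2 := main (fun i => - c i) (fun i hi => by simp [hc0 i hi])
    (fun j => by simp [Finset.sum_neg_distrib, hcv j])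
  simp only [neg_mul, Finset.sum_neg_distrib] at h2
  have h3 : ∑ i, c i * (w i : ℝ) = 0 := by linarith
  have hq : t = ((∑ i, φ (a i) * w i : ℚ) : ℝ) := by
    simp only [c, sub_mul, Finset.sum_sub_distrib] at h3
    push_cast
    linarith
  refine ⟨⟨_, hq⟩, fun hx hwp => ⟨_, ?_, hq⟩⟩
  have htpos : 0 < t := by
    have hnn : ∀ i ∈ Finset.univ, 0 ≤ a i * (w i : ℝ) := fun i _ =>
      mul_nonneg (ha i) (by exact_mod_cast hw i)
    rcases (Finset.sum_nonneg hnn).eq_or_lt with h0 | h0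
    · exfalso
      apply hx
      have hz := (Finset.sum_eq_zero_iff_of_nonneg hnn).1 h0.symm
      funext j
      have ha0 : ∀ i, a i = 0 := fun i => by
        have hwi : (w i : ℝ) ≠ 0 := by exact_mod_cast (hwp i).ne'
        exact (mul_eq_zero.1 (hz i (Finset.mem_univ i))).resolve_right hwi
      show (x j : ℝ) = 0
      rw [hax j]; simp [ha0]
    · rwa [hat]
  rw [hq] at htpos
  exact_mod_cast htpos
end

section
/- Let P ⊆ ℝ^d × ℝ be a finite set, Q₀ := convexHull(P), and let p ∈ ℝ^d × ℝ with Q₁ := convexHull(P ∪ {p}). Set D := dim(convexHull(π(P))) and assume dim(convexHull(π(P) ∪ {π(p)})) = D. Assume further: (i) every exposed lower face of Q₀ is a simplex (the convex hull of an affinely independent set); and (ii) for every lower functional u whose exposed lower face of Q₀ has dimension D, one has u(p) > min_{Q₀} u. Then every exposed lower face of Q₁ of dimension D is a simplex. -/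
open Set

/-- A simplex: the convex hull of an affinely independent finite set. -/
def IsSimplex {V : Type*} [AddCommGroup V] [Module ℝ V] (s : Set V) : Prop :=
  ∃ t : Finset V, AffineIndependent ℝ (fun x : (t : Set V) => x.1) ∧ s = convexHull ℝ (t : Set V)

/-- Adjoining a point outside the affine span keeps affine independence. -/
lemma aux_insert {V : Type*} [AddCommGroup V] [Module ℝ V] (t : Set V) (p : V)
    (ht : AffineIndependent ℝ (fun x : t => x.1)) (hp : p ∉ affineSpan ℝ t) :
    AffineIndependent ℝ (fun x : (insert p t : Set V) => x.1) := by
  have hpt : p ∉ t := fun h => hp (subset_affineSpan ℝ t h)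
  refine AffineIndependent.affineIndependent_of_notMem_span
    (i := (⟨p, mem_insert p t⟩ : (insert p t : Set V))) ?_ ?_
  · let f : {y : (insert p t : Set V) // y ≠ ⟨p, mem_insert p t⟩} ↪ t :=
      ⟨fun y => ⟨y.1.1, by
        rcases y.1.2 with h | h
        · exact absurd (Subtype.ext h) y.2
        · exact h⟩, by
        intro a b h
        have h' := congrArg Subtype.val h
        exact Subtype.ext (Subtype.ext h')⟩
    exact ht.comp_embedding f
  · intro h
    apply hp
    refine affineSpan_mono ℝ ?_ h
    rintro _ ⟨y, hy, rfl⟩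
    rcases y.2 with h | h
    · exact absurd (Subtype.ext h) hy
    · exact h

/-- let `Q₀ = conv P` and `Q₁ = conv (P ∪ {p})` with
`D = dim conv (π '' P) = dim conv (π '' P ∪ {π p})`. If every exposed lower face of `Q₀` is a
simplex and `u p > min_{Q₀} u` for every lower functional `u` whose exposed lower face of `Q₀`
has dimension `D`, then every exposed lower face of `Q₁` of dimension `D` is a simplex. -/
theorem stmt9 (d : ℕ) (P : Finset ((Fin d → ℝ) × ℝ)) (p : (Fin d → ℝ) × ℝ)
    (hdim : setDim (convexHull ℝ (insert p.1 (Prod.fst '' (P : Set ((Fin d → ℝ) × ℝ))))) =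
            setDim (convexHull ℝ (Prod.fst '' (P : Set ((Fin d → ℝ) × ℝ)))))
    (hsimplex : ∀ u : ((Fin d → ℝ) × ℝ) →ₗ[ℝ] ℝ, IsLowerFn u →
      IsSimplex (lowerFace (convexHull ℝ (P : Set ((Fin d → ℝ) × ℝ))) u))
    (hbeyond : ∀ u : ((Fin d → ℝ) × ℝ) →ₗ[ℝ] ℝ, IsLowerFn u →
      setDim (lowerFace (convexHull ℝ (P : Set ((Fin d → ℝ) × ℝ))) u) =
        setDim (convexHull ℝ (Prod.fst '' (P : Set ((Fin d → ℝ) × ℝ)))) →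
      ∀ c : ℝ, IsLeast (u '' convexHull ℝ (P : Set ((Fin d → ℝ) × ℝ))) c → c < u p) :
    ∀ u : ((Fin d → ℝ) × ℝ) →ₗ[ℝ] ℝ, IsLowerFn u →
      setDim (lowerFace (convexHull ℝ (insert p (P : Set ((Fin d → ℝ) × ℝ)))) u) =
        setDim (convexHull ℝ (Prod.fst '' (P : Set ((Fin d → ℝ) × ℝ)))) →
      IsSimplex (lowerFace (convexHull ℝ (insert p (P : Set ((Fin d → ℝ) × ℝ)))) u) := by
  classical
  intro u hu hD
  rcases P.eq_empty_or_nonempty with rfl | hne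
  · refine ⟨{p}, ?_, ?_⟩
    · have : Subsingleton (({p} : Finset ((Fin d → ℝ) × ℝ)) : Set ((Fin d → ℝ) × ℝ)) := by
        simp only [Finset.coe_singleton]
        infer_instance
      exact affineIndependent_of_subsingleton ℝ _
    · ext z
      simp only [lowerFace, Finset.coe_empty, insert_empty_eq, convexHull_singleton,
        Finset.coe_singleton, mem_setOf_eq, mem_singleton_iff]
      constructor
      · exact fun h => h.1
      · rintro rfl
        exact ⟨rfl, fun y hy => by rw [hy]⟩
  obtain ⟨x₀, hx₀, hmin⟩ := P.exists_min_image u hne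
  set Q := convexHull ℝ (P : Set ((Fin d → ℝ) × ℝ)) with hQ
  have hx₀Q : x₀ ∈ Q := subset_convexHull ℝ _ hx₀
  have hmQ : ∀ y ∈ Q, u x₀ ≤ u y := by
    have : Q ⊆ {y | u x₀ ≤ u y} :=
      convexHull_min (fun y hy => hmin y hy) (convex_halfSpace_ge u.isLinear _)
    exact this
  have hQ1 : ∀ z, z ∈ convexHull ℝ (insert p (P : Set ((Fin d → ℝ) × ℝ))) ↔
      ∃ q ∈ Q, ∃ a b : ℝ, 0 ≤ a ∧ 0 ≤ b ∧ a + b = 1 ∧ a • p + b • q = z := by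
    intro z
    rw [convexHull_insert (by exact_mod_cast hne), mem_convexJoin]
    simp [segment, hQ]
  have hp1 : p ∈ convexHull ℝ (insert p (P : Set ((Fin d → ℝ) × ℝ))) :=
    subset_convexHull ℝ _ (mem_insert _ _)
  have hQQ : Q ⊆ convexHull ℝ (insert p (P : Set ((Fin d → ℝ) × ℝ))) :=
    convexHull_mono (subset_insert _ _)
  rcases lt_trichotomy (u p) (u x₀) with hlt | heq | hgt
  · refine ⟨{p}, ?_, ?_⟩
    · have : Subsingleton (({p} : Finset ((Fin d → ℝ) × ℝ)) : Set ((Fin d → ℝ) × ℝ)) := by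
        simp only [Finset.coe_singleton]
        infer_instance
      exact affineIndependent_of_subsingleton ℝ _
    · ext z
      simp only [lowerFace, Finset.coe_singleton, convexHull_singleton, mem_setOf_eq,
        mem_singleton_iff]
      constructor
      · rintro ⟨hz, hz'⟩
        obtain ⟨q, hq, a, b, ha, hb, hab, rfl⟩ := (hQ1 z).1 hz
        have h1 := hz' p hp1
        have h2 := hmQ q hq
        simp only [map_add, map_smul, smul_eq_mul] at h1
        have hb0 : b = 0 := by
          by_contra hb0
          have : 0 < b := lt_of_le_of_ne hb (Ne.symm hb0)
          obtain rfl : a = 1 - b := by linarith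
          nlinarith
        obtain rfl : a = 1 := by linarith
        simp [hb0]
      · rintro rfl
        refine ⟨hp1, fun y hy => ?_⟩
        obtain ⟨q, hq, a, b, ha, hb, hab, rfl⟩ := (hQ1 y).1 hy
        have h2 := hmQ q hq
        simp only [map_add, map_smul, smul_eq_mul]
        obtain rfl : a = 1 - b := by linarith
        nlinarith
  · have hm1 : ∀ y ∈ convexHull ℝ (insert p (P : Set ((Fin d → ℝ) × ℝ))), u x₀ ≤ u y := by
      intro y hy
      obtain ⟨q, hq, a, b, ha, hb, hab, rfl⟩ := (hQ1 y).1 hy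
      have h2 := hmQ q hq
      simp only [map_add, map_smul, smul_eq_mul, heq]
      obtain rfl : a = 1 - b := by linarith
      nlinarith
    obtain ⟨t, ht, hF⟩ := hsimplex u hu
    have hx₀F : x₀ ∈ convexHull ℝ (t : Set ((Fin d → ℝ) × ℝ)) := hF ▸ ⟨hx₀Q, hmQ⟩
    have htne : (t : Set ((Fin d → ℝ) × ℝ)).Nonempty :=
      convexHull_nonempty_iff.1 ⟨x₀, hx₀F⟩
    have hF1 : lowerFace (convexHull ℝ (insert p (P : Set ((Fin d → ℝ) × ℝ)))) u =
        convexHull ℝ (insert p (t : Set ((Fin d → ℝ) × ℝ))) := by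
      rw [convexHull_insert htne, ← hF]
      ext z
      simp only [mem_convexJoin, mem_singleton_iff, exists_eq_left]
      constructor
      · rintro ⟨hz, hz'⟩
        obtain ⟨q, hq, a, b, ha, hb, hab, rfl⟩ := (hQ1 z).1 hz
        have h1 := hz' p hp1
        have h2 := hmQ q hq
        simp only [map_add, map_smul, smul_eq_mul] at h1
        rcases hb.eq_or_lt with hb0 | hb0
        · obtain rfl : a = 1 := by linarith
          exact ⟨x₀, ⟨hx₀Q, hmQ⟩, 1, 0, by norm_num, le_rfl, by norm_num, by simp [← hb0]⟩
        · refine ⟨q, ⟨hq, fun y hy => ?_⟩, a, b, ha, hb, hab, rfl⟩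
          have h3 := hmQ y hy
          obtain rfl : a = 1 - b := by linarith
          have : u q ≤ u x₀ := by
            by_contra hc
            push Not at hc
            nlinarith
          linarith
      · rintro ⟨q, ⟨hq, hq'⟩, a, b, ha, hb, hab, rfl⟩
        refine ⟨(hQ1 _).2 ⟨q, hq, a, b, ha, hb, hab, rfl⟩, fun y hy => ?_⟩
        have h1 := hm1 y hy
        have h2 : u q = u x₀ := le_antisymm (hq' _ hx₀Q) (hmQ q hq)
        simp only [map_add, map_smul, smul_eq_mul, heq, h2]
        rw [← add_mul, hab, one_mul]
        exact h1
    refine ⟨insert p t, ?_, by rw [hF1, Finset.coe_insert]⟩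
    rw [Finset.coe_insert]
    refine aux_insert _ _ ht fun hmem => ?_
    have hdim0 : setDim (lowerFace Q u) =
        setDim (convexHull ℝ (Prod.fst '' (P : Set ((Fin d → ℝ) × ℝ)))) := by
      rw [← hD, hF1, hF]
      unfold setDim
      rw [affineSpan_convexHull, affineSpan_convexHull, affineSpan_insert_eq_affineSpan ℝ hmem]
    have := hbeyond u hu hdim0 (u x₀)
      ⟨⟨x₀, hx₀Q, rfl⟩, by rintro _ ⟨y, hy, rfl⟩; exact hmQ y hy⟩
    linarith
  · have : lowerFace (convexHull ℝ (insert p (P : Set ((Fin d → ℝ) × ℝ)))) u = lowerFace Q u := by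
      ext z
      constructor
      · rintro ⟨hz, hz'⟩
        refine ⟨?_, fun y hy => hz' y (hQQ hy)⟩
        obtain ⟨q, hq, a, b, ha, hb, hab, rfl⟩ := (hQ1 z).1 hz
        have h1 := hz' x₀ (hQQ hx₀Q)
        have h2 := hmQ q hq
        simp only [map_add, map_smul, smul_eq_mul] at h1
        have ha0 : a = 0 := by
          by_contra ha0
          have : 0 < a := lt_of_le_of_ne ha (Ne.symm ha0)
          obtain rfl : b = 1 - a := by linarith
          nlinarith
        obtain rfl : b = 1 := by linarith
        simpa [ha0] using hq
      · rintro ⟨hz, hz'⟩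
        refine ⟨hQQ hz, fun y hy => ?_⟩
        obtain ⟨q, hq, a, b, ha, hb, hab, rfl⟩ := (hQ1 y).1 hy
        have h1 := hz' x₀ hx₀Q
        have h2 := hmQ q hq
        simp only [map_add, map_smul, smul_eq_mul]
        obtain rfl : a = 1 - b := by linarith
        nlinarith
    rw [this]
    exact hsimplex u hu
end
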